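/- Let D be a division ring whose center F is infinite, and let f(x_1,…,x_m) be a multilinear polynomial over F that is non-central over M_2(F). If for every choice of nonzero a_1,…,a_m ∈ D the value f(a_1,…,a_m) is algebraic over F of degree at most some fixed bound, then D is finite-dimensional over F. -/

import Mathlib

/-- Evaluation of the multilinear polynomial
`f(x_1,…,x_m) = ∑_{σ ∈ S_m} c σ • x_{σ(1)} x_{σ(2)} ⋯ x_{σ(m)}`
(given by its coefficient family `c`) at the tuple `T` in an `F`-algebra `R`. -/
def mlEval {F : Type*} [CommSemiring F] {m : ℕ} (c : Equiv.Perm (Fin m) → F)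
    {R : Type*} [Ring R] [Algebra F R] (T : Fin m → R) : R :=
  ∑ σ : Equiv.Perm (Fin m), c σ • (List.ofFn fun i => T (σ i)).prod

open Polynomial

lemma finrank_lemma {F D : Type*} [Field F] [DivisionRing D] [Algebra F D]
    (hcenter : Set.range (algebraMap F D) = Set.center D) {ι : Type*} [DecidableEq ι]
    (a : ι → D) (P : Finset ι) : ∀ (_ : LinearIndepOn F a (P : Set ι)) (q : ι → D)
    (E : Submodule F D) (_ : FiniteDimensional F E) (_ : ∀ y, ∑ p ∈ P, a p * y * q p ∈ E)
    (_ : ∃ p ∈ P, q p ≠ 0), FiniteDimensional F D := by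
  induction P using Finset.induction_on with
  | empty => intro _ _ _ _ _ h; simp at h
  | insert n P hn ih =>
    intro hP q E hE hy hq
    have hP' : LinearIndepOn F a (P : Set ι) := hP.mono (by simp)
    by_cases hqn : q n = 0
    · refine ih hP' q E hE (fun y => ?_) ?_
      · have := hy y
        rw [Finset.sum_insert hn, hqn] at this
        simpa using this
      · obtain ⟨p, hp, hpq⟩ := hq
        rcases Finset.mem_insert.1 hp with rfl | hp
        · exact absurd hqn hpq
        · exact ⟨p, hp, hpq⟩
    -- normalise
    set r : ι → D := fun p => q p * (q n)⁻¹ with hr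
    set E1 := E.map (LinearMap.mulRight F (q n)⁻¹) with hE1
    have hy1 : ∀ y, ∑ p ∈ insert n P, a p * y * r p ∈ E1 := by
      intro y
      refine ⟨_, hy y, ?_⟩
      simp [hr, mul_assoc]
    have hrn : r n = 1 := by simp [hr, hqn]
    by_cases hc : ∃ b, ∃ p ∈ P, b * r p - r p * b ≠ 0
    · obtain ⟨b, hb⟩ := hc
      refine ih hP' (fun p => b * r p - r p * b) (E1 ⊔ E1.map (LinearMap.mulRight F b))
        inferInstance (fun y => ?_) hb
      have h1 := hy1 (y * b)
      have h2 : (∑ p ∈ insert n P, a p * y * r p) * b ∈ E1.map (LinearMap.mulRight F b) :=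
        ⟨_, hy1 y, by rw [LinearMap.mulRight_apply]⟩
      have h3 := Submodule.sub_mem _ (Submodule.mem_sup_left h1 (T := E1.map (LinearMap.mulRight F b)))
        (Submodule.mem_sup_right h2 (S := E1))
      convert h3 using 1
      rw [Finset.sum_insert hn, Finset.sum_insert hn, hrn, add_mul, Finset.sum_mul]
      simp only [mul_sub, Finset.sum_sub_distrib, mul_assoc, mul_one]
      abel
    · push Not at hc
      have hcen : ∀ p ∈ insert n P, ∃ k : F, algebraMap F D k = r p := by
        intro p hp
        have : r p ∈ Set.center D := by
          rw [Semigroup.mem_center_iff]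
          intro b
          rcases Finset.mem_insert.1 hp with rfl | hp
          · simp [hrn]
          · exact sub_eq_zero.1 (hc b p hp)
        rw [← hcenter] at this
        exact this
      choose! k hk using hcen
      set s := ∑ p ∈ insert n P, k p • a p with hs
      have hs0 : s ≠ 0 := by
        intro h0
        have := (linearIndepOn_finset_iff.1 hP) k h0 n (by simp)
        have h2 := hk n (by simp)
        rw [this, hrn] at h2
        simp at h2
      have hsy : ∀ y, s * y ∈ E1 := by
        intro y
        convert hy1 y using 1
        rw [hs, Finset.sum_mul]
        refine Finset.sum_congr rfl fun p hp => ?_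
        rw [← hk p hp, ← Algebra.commutes, Algebra.smul_def]
        rw [mul_assoc]
      have : E1 = ⊤ := by
        rw [eq_top_iff]
        intro y _
        have := hsy (s⁻¹ * y)
        rwa [← mul_assoc, mul_inv_cancel₀ hs0, one_mul] at this
      have hf : FiniteDimensional F E1 := inferInstance
      rw [this] at hf
      exact Module.finite_def.2 ((Submodule.fg_top _).1 (Module.finite_def.1 hf) |> fun h => by simpa using h)

lemma indep_open {F D : Type*} [Field F] [Infinite F] [DivisionRing D] [Algebra F D]
    {ι : Type*} [Fintype ι] [DecidableEq ι] (v : ι → D[X])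
    (h : LinearIndependent F (fun i => (v i).coeff 0)) :
    ∃ t : F, t ≠ 0 ∧ LinearIndependent F (fun i => (v i).eval (algebraMap F D t)) := by
  obtain ⟨φ, hφ⟩ : ∃ φ : ι → D →ₗ[F] F, ∀ i j, φ j ((v i).coeff 0) = if i = j then 1 else 0 := by
    obtain ⟨g, hg⟩ := LinearMap.exists_leftInverse_of_injective
      (Fintype.linearCombination F (fun i => (v i).coeff 0))
      (LinearMap.ker_eq_bot'.2 (fun z hz => funext (Fintype.linearIndependent_iff.1 h z (by simpa [Fintype.linearCombination_apply] using hz))))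
    refine ⟨fun j => (LinearMap.proj j).comp g, fun i j => ?_⟩
    have := congrArg (fun f => f (Pi.single i 1) j) hg
    simp [Fintype.linearCombination_apply_single] at this
    simp [this, Pi.single_apply, eq_comm]
  -- polynomial entries
  let M : Matrix ι ι F[X] := fun i j =>
    ∑ k ∈ Finset.range ((v i).natDegree + 1), C (φ j ((v i).coeff k)) * X ^ k
  have hM : ∀ i j t, (M i j).eval t = φ j ((v i).eval (algebraMap F D t)) := by
    intro i j t
    simp only [M, eval_finsetSum, eval_mul, eval_C, eval_pow, eval_X]
    rw [eval_eq_sum_range, map_sum]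
    refine Finset.sum_congr rfl fun k _ => ?_
    rw [← map_pow, ← Algebra.commutes, ← Algebra.smul_def, map_smul, smul_eq_mul, mul_comm]
  have hdet : ∀ t, M.det.eval t = (Matrix.of fun i j => φ j ((v i).eval (algebraMap F D t))).det := by
    intro t
    rw [← coe_evalRingHom, RingHom.map_det]
    congr 1
    ext i j
    simp [hM]
  have h0 : M.det ≠ 0 := by
    intro h0
    have := hdet 0
    rw [h0] at this
    have h1 : (Matrix.of fun i j => φ j ((v i).eval (algebraMap F D 0))) = 1 := by
      ext i j
      simp [← coeff_zero_eq_eval_zero, hφ, Matrix.one_apply]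
    rw [h1] at this
    simp at this
  obtain ⟨t, ht⟩ : ∃ t, (X * M.det).eval t ≠ 0 := by
    by_contra! hcon
    exact (mul_ne_zero X_ne_zero h0) (Polynomial.funext (by simpa using hcon))
  rw [eval_mul, eval_X] at ht
  refine ⟨t, left_ne_zero_of_mul ht, ?_⟩
  have hdt := right_ne_zero_of_mul ht
  rw [hdet] at hdt
  have hli := Matrix.linearIndependent_rows_of_det_ne_zero hdt
  exact LinearIndependent.of_comp (LinearMap.pi φ) hli

lemma perturb {F D : Type*} [Field F] [Infinite F] [DivisionRing D] [Algebra F D]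
    {ι : Type*} [Fintype ι] [DecidableEq ι] (v : ι → D[X]) (u : D[X]) (lam : ι → F)
    (h : LinearIndependent F (fun i => (v i).coeff 0))
    (hu : u.coeff 0 = ∑ i, lam i • (v i).coeff 0)
    (hE : u.coeff 1 - ∑ i, lam i • (v i).coeff 1 ∉
      Submodule.span F (Set.range fun i => (v i).coeff 0)) :
    ∃ t : F, LinearIndependent F (fun i => (v i).eval (algebraMap F D t)) ∧
      u.eval (algebraMap F D t) ∉
        Submodule.span F (Set.range fun i => (v i).eval (algebraMap F D t)) := by
  set g := u - ∑ i, C (algebraMap F D (lam i)) * v i with hg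
  have hg0 : g.coeff 0 = 0 := by
    simp [hg, hu, Algebra.smul_def]
  have hg1 : g.divX.coeff 0 = u.coeff 1 - ∑ i, lam i • (v i).coeff 1 := by
    simp [hg, Algebra.smul_def]
  have hgX : g = g.divX * X := by
    conv_lhs => rw [← divX_mul_X_add g, hg0]
    simp
  obtain ⟨t, ht0, ht⟩ := indep_open (F := F) (D := D) (fun o : Option ι => o.elim g.divX v) (by
    rw [linearIndependent_option]
    refine ⟨by simpa [Function.comp_def] using h, ?_⟩
    simpa only [Function.comp_def, Option.elim, hg1] using hE)
  rw [linearIndependent_option] at ht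
  refine ⟨t, by simpa [Function.comp_def] using ht.1, fun hmem => ht.2 ?_⟩
  simp only [Function.comp_def, Option.elim]
  have hev : g.eval (algebraMap F D t) = t • g.divX.eval (algebraMap F D t) := by
    conv_lhs => rw [hgX]
    rw [eval_mul_X, Algebra.smul_def, Algebra.commutes]
  have hev2 : g.eval (algebraMap F D t) = u.eval (algebraMap F D t)
      - ∑ i, lam i • (v i).eval (algebraMap F D t) := by
    simp [hg, eval_finsetSum, Algebra.smul_def]
  have : g.divX.eval (algebraMap F D t) = t⁻¹ • (u.eval (algebraMap F D t)
      - ∑ i, lam i • (v i).eval (algebraMap F D t)) := by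
    rw [← hev2, hev, smul_smul, inv_mul_cancel₀ ht0, one_smul]
  rw [this]
  refine Submodule.smul_mem _ _ (Submodule.sub_mem _ hmem (Submodule.sum_mem _ fun i _ =>
    Submodule.smul_mem _ _ (Submodule.subset_span ⟨i, rfl⟩)))

/-- Evaluation of a word. -/
def wordEv {α R : Type*} [Monoid R] (x : α → R) (l : List α) : R := (l.map x).prod

lemma coeff_zero_wordEv {α D : Type*} [DivisionRing D] [DecidableEq α] (x : α → D) (i : α) (y : D)
    (l : List α) :
    (wordEv (fun j => C (x j) + if j = i then C y * X else 0) l).coeff 0 = wordEv x l := by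
  induction l with
  | nil => simp [wordEv]
  | cons j l ih =>
    simp only [wordEv, List.map_cons, List.prod_cons, mul_coeff_zero] at ih ⊢
    rw [ih]
    split_ifs <;> simp

lemma coeff_one_wordEv {α D : Type*} [DivisionRing D] [DecidableEq α] (x : α → D) (i : α) (y : D)
    (l : List α) :
    (wordEv (fun j => C (x j) + if j = i then C y * X else 0) l).coeff 1 =
      ∑ k ∈ Finset.range l.length, if l[k]? = some i then
        wordEv x (l.take k) * y * wordEv x (l.drop (k + 1)) else 0 := by
  induction l with
  | nil => simp [wordEv, coeff_one]
  | cons j l ih =>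
    have h0 := coeff_zero_wordEv x i y l
    simp only [wordEv, List.map_cons, List.prod_cons, mul_coeff_one] at ih h0 ⊢
    rw [ih, h0, List.length_cons, Finset.sum_range_succ']
    congr 1
    · rw [Finset.mul_sum]
      refine Finset.sum_congr rfl fun k _ => ?_
      split_ifs <;> simp_all [mul_assoc]
    · by_cases h : j = i <;> simp [h, coeff_C]

lemma eval_wordEv {F α D : Type*} [Field F] [DivisionRing D] [Algebra F D] [DecidableEq α]
    (x : α → D[X]) (t : F) (l : List α) :
    (wordEv x l).eval (algebraMap F D t) = wordEv (fun j => (x j).eval (algebraMap F D t)) l := by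
  induction l with
  | nil => simp [wordEv]
  | cons j l ih =>
    simp only [wordEv, List.map_cons, List.prod_cons] at ih ⊢
    rw [← ih]
    exact map_mul (eval₂RingHom' (RingHom.id D) (algebraMap F D t)
      (fun a => (Algebra.commutes t a).symm)) _ _

lemma insert_step {F D α : Type*} [Field F] [Infinite F] [DivisionRing D] [Algebra F D]
    [Finite α] [DecidableEq α]
    (hcenter : Set.range (algebraMap F D) = Set.center D) (hinf : ¬ FiniteDimensional F D)
    (N : ℕ) (A : Finset (List α)) (hA : ∀ l : List α, l.length ≤ N → l ∈ A)
    (hA2 : ∀ l ∈ A, l.length ≤ N + 1) (w : List α) (hw : w.length = N + 1) (hwA : w ∉ A)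
    (x : α → D) (hx : LinearIndepOn F (wordEv x) (A : Set (List α))) :
    ∃ x' : α → D, LinearIndepOn F (wordEv x') (insert w (A : Set (List α))) := by
  by_cases h : wordEv x w ∈ Submodule.span F (wordEv x '' A)
  swap
  · exact ⟨x, hx.insert h⟩
  obtain ⟨p0, i, rfl⟩ : ∃ p0 i, w = p0 ++ [i] := by
    rcases List.eq_nil_or_concat w with rfl | ⟨p, i, rfl⟩
    · simp at hw
    · exact ⟨p, i, by simp⟩
  have hp0 : p0.length = N := by simpa using hw
  have himg : ∀ z : α → D, wordEv z '' (A : Set (List α)) = Set.range (fun v : A => wordEv z v) := by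
    intro z; ext; simp
  rw [himg] at h
  obtain ⟨lam, hlam⟩ := (Submodule.mem_span_range_iff_exists_fun F).1 h
  set P : Finset (List α) := (List.finite_length_le α N).toFinset with hP
  have hPmem : ∀ l, l ∈ P ↔ l.length ≤ N := by simp [hP]
  have hPA : (P : Set (List α)) ⊆ A := fun l hl => hA l ((hPmem l).1 hl)
  set E := Submodule.span F (Set.range (fun v : A => wordEv x v)) with hE
  have hEf : FiniteDimensional F E := FiniteDimensional.span_of_finite F (Set.finite_range _)
  let r : List α → List α → D := fun v p => ∑ k ∈ Finset.range v.length,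
    if v[k]? = some i ∧ p = v.take k then wordEv x (v.drop (k + 1)) else 0
  let δ : List α → D → D := fun v y => ∑ k ∈ Finset.range v.length, if v[k]? = some i then
        wordEv x (v.take k) * y * wordEv x (v.drop (k + 1)) else 0
  have hδ : ∀ v y, v.length ≤ N + 1 → δ v y = ∑ p ∈ P, wordEv x p * y * r v p := by
    intro v y hv
    simp only [δ, r, Finset.mul_sum]
    rw [Finset.sum_comm]
    refine Finset.sum_congr rfl fun k hk => ?_
    have hkP : v.take k ∈ P := by
      rw [hPmem, List.length_take]
      have := Finset.mem_range.1 hk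
      omega
    by_cases hki : v[k]? = some i
    · simp [hki, hkP]
    · simp [hki]
  have hr0 : ∀ v, v.length ≤ N + 1 → v ≠ p0 ++ [i] → r v p0 = 0 := by
    intro v hv hne
    refine Finset.sum_eq_zero fun k hk => if_neg ?_
    rintro ⟨h1, h2⟩
    have hk := Finset.mem_range.1 hk
    have h3 : k = N := by
      have := congrArg List.length h2
      rw [List.length_take] at this
      omega
    apply hne
    have h4 : v = v.take (k + 1) := by rw [List.take_of_length_le (by omega)]
    rw [h4, List.take_add_one, ← h2, h1]
    rfl
  have hrw : r (p0 ++ [i]) p0 = 1 := by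
    simp only [r]
    rw [Finset.sum_eq_single N]
    · simp [← hp0, wordEv]
    · intro k hk hkN
      refine if_neg ?_
      rintro ⟨h1, h2⟩
      have := congrArg List.length h2
      have hk := Finset.mem_range.1 hk
      rw [List.length_take] at this
      omega
    · simp [hp0]
  let q : List α → D := fun p => r (p0 ++ [i]) p - ∑ v : A, lam v • r v p
  have hq : q p0 ≠ 0 := by
    have : ∑ v : A, lam v • r v p0 = 0 := by
      refine Finset.sum_eq_zero fun v _ => ?_
      rw [hr0 v (hA2 v v.2) (fun h => hwA (h ▸ v.2)), smul_zero]
    simp only [q]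
    rw [this, hrw, sub_zero]
    exact one_ne_zero
  obtain ⟨y, hy⟩ : ∃ y, ∑ p ∈ P, wordEv x p * y * q p ∉ E := by
    by_contra! hcon
    exact hinf (finrank_lemma hcenter (wordEv x) P (hx.mono hPA) q E hEf hcon
      ⟨p0, by simp [hPmem, hp0], hq⟩)
  have hsum : ∑ p ∈ P, wordEv x p * y * q p = δ (p0 ++ [i]) y - ∑ v : A, lam v • δ v y := by
    rw [hδ _ _ hw.le]
    have : ∑ v : A, lam v • δ v y = ∑ v : A, lam v • ∑ p ∈ P, wordEv x p * y * r v p :=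
      Finset.sum_congr rfl fun v _ => by rw [hδ v y (hA2 v v.2)]
    rw [this]
    simp only [q, mul_sub, Finset.sum_sub_distrib, Finset.smul_sum, Finset.mul_sum]
    rw [Finset.sum_comm]
    simp
  rw [hsum] at hy
  obtain ⟨t, ht1, ht2⟩ := perturb (F := F) (D := D)
    (fun v : A => wordEv (fun j => C (x j) + if j = i then C y * X else 0) v.1)
    (wordEv (fun j => C (x j) + if j = i then C y * X else 0) (p0 ++ [i])) lam
    (by simp only [coeff_zero_wordEv]; exact hx)
    (by simpa only [coeff_zero_wordEv] using hlam.symm)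
    (by simpa only [coeff_zero_wordEv, coeff_one_wordEv] using hy)
  simp only [eval_wordEv] at ht1 ht2
  rw [← himg] at ht2
  exact ⟨_, LinearIndepOn.insert ht1 ht2⟩

lemma words_indep {F D α : Type*} [Field F] [Infinite F] [DivisionRing D] [Algebra F D]
    [Finite α] [DecidableEq α]
    (hcenter : Set.range (algebraMap F D) = Set.center D) (hinf : ¬ FiniteDimensional F D)
    (N : ℕ) : ∃ x : α → D, LinearIndepOn F (wordEv x) {l : List α | l.length ≤ N} := by
  induction N with
  | zero =>
    refine ⟨0, ?_⟩
    have : {l : List α | l.length ≤ 0} = {[]} := by ext; simp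
    rw [this]
    simp [wordEv]
  | succ N ih =>
    have key : ∀ B : Finset (List α), (∀ l ∈ B, l.length = N + 1) →
        ∃ x : α → D, LinearIndepOn F (wordEv x) ({l : List α | l.length ≤ N} ∪ B) := by
      intro B
      induction B using Finset.induction_on with
      | empty => intro _; simpa using ih
      | insert w B hw ihB =>
        intro hB
        obtain ⟨x, hx⟩ := ihB (fun l hl => hB l (by simp [hl]))
        have hwl := hB w (by simp)
        have hc : (((List.finite_length_le α N).toFinset ∪ B : Finset (List α)) : Set (List α)) =
          {l : List α | l.length ≤ N} ∪ B := by simp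
        obtain ⟨x', hx'⟩ := insert_step hcenter hinf N ((List.finite_length_le α N).toFinset ∪ B)
          (fun l hl => by simp [hl]) (fun l hl => by
            rcases Finset.mem_union.1 hl with h | h
            · have : l.length ≤ N := by simpa using h
              omega
            · exact (hB l (by simp [h])).le) w hwl (by simp [hwl, hw]) x (by rw [hc]; exact hx)
        refine ⟨x', ?_⟩
        rw [hc] at hx'
        convert hx' using 1
        rw [Finset.coe_insert, Set.union_insert]
    obtain ⟨x, hx⟩ := key (List.finite_length_eq α (N + 1)).toFinset (by simp)
    refine ⟨x, hx.mono ?_⟩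
    intro l hl
    have : l.length ≤ N + 1 := hl
    simp only [Set.Finite.coe_toFinset, Set.mem_union, Set.mem_ofPred_eq]
    omega

lemma mlEval_map {F R S : Type*} [Field F] [Ring R] [Algebra F R] [Ring S] [Algebra F S]
    {m : ℕ} (c : Equiv.Perm (Fin m) → F) (φ : R →ₐ[F] S) (T : Fin m → R) :
    φ (mlEval c T) = mlEval c (fun i => φ (T i)) := by
  simp only [mlEval, map_sum, map_smul, map_list_prod, List.map_ofFn]
  rfl

/-- The generic value of the multilinear polynomial, in the free algebra. -/
noncomputable def mlGen {F : Type*} [Field F] {m : ℕ} (c : Equiv.Perm (Fin m) → F) :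
    MonoidAlgebra F (FreeMonoid (Fin m)) :=
  mlEval c (fun i => MonoidAlgebra.single (FreeMonoid.of i) 1)

lemma mlGen_eq {F : Type*} [Field F] {m : ℕ} (c : Equiv.Perm (Fin m) → F) :
    mlGen c = ∑ σ : Equiv.Perm (Fin m),
      MonoidAlgebra.single (FreeMonoid.ofList (List.ofFn fun i => σ i)) (c σ) := by
  refine Finset.sum_congr rfl fun σ _ => ?_
  have : ∀ l : List (Fin m), (l.map fun i => (MonoidAlgebra.single (FreeMonoid.of i) 1 :
      MonoidAlgebra F (FreeMonoid (Fin m)))).prod = MonoidAlgebra.single (FreeMonoid.ofList l) 1 := by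
    intro l
    induction l with
    | nil => rfl
    | cons a l ih =>
      rw [List.map_cons, List.prod_cons, ih, MonoidAlgebra.single_mul_single, one_mul]
      rfl
  have h := this (List.ofFn fun i => σ i)
  rw [List.map_ofFn] at h
  simp only [Function.comp_def] at h
  rw [h]
  simp

lemma mlGen_ne_zero {F : Type*} [Field F] {m : ℕ} (c : Equiv.Perm (Fin m) → F) (hc : c ≠ 0) :
    mlGen c ≠ 0 := by
  obtain ⟨σ, hσ⟩ := Function.ne_iff.1 hc
  intro h
  rw [mlGen_eq] at h
  have hinj : Function.Injective (fun σ : Equiv.Perm (Fin m) =>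
      FreeMonoid.ofList (List.ofFn fun i => σ i)) := by
    intro σ τ h
    have := List.ofFn_injective (FreeMonoid.ofList.injective h)
    exact Equiv.ext (congrFun this)
  have h2 := congrArg (fun g => (MonoidAlgebra.coeff g)
    (FreeMonoid.ofList (List.ofFn fun i => σ i))) h
  classical
  simp only [MonoidAlgebra.coeff_sum, Finsupp.finsetSum_apply,
    MonoidAlgebra.coeff_single_apply, MonoidAlgebra.coeff_zero, Finsupp.zero_apply] at h2
  rw [Finset.sum_eq_single σ] at h2
  · rw [if_pos rfl] at h2
    exact hσ h2
  · intro τ _ hτ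
    exact if_neg (fun h => hτ (hinj h))
  · simp

lemma mlGen_transc {F : Type*} [Field F] {m : ℕ} (hm : m ≠ 0) (c : Equiv.Perm (Fin m) → F)
    (hc : c ≠ 0) (p : F[X]) (hp : aeval (mlGen c) p = 0) : p = 0 := by
  let ψ : FreeMonoid (Fin m) →* (MonoidAlgebra F (FreeMonoid (Fin m)))[X] :=
    FreeMonoid.lift fun i => monomial 1 (MonoidAlgebra.single (FreeMonoid.of i) 1)
  let Ψ := MonoidAlgebra.lift F (MonoidAlgebra F (FreeMonoid (Fin m)))[X] (FreeMonoid (Fin m)) ψ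
  have hl : ∀ l : List (MonoidAlgebra F (FreeMonoid (Fin m))),
      (l.map (monomial 1)).prod = monomial l.length l.prod := by
    intro l
    induction l with
    | nil => rfl
    | cons a l ih =>
      rw [List.map_cons, List.prod_cons, ih, monomial_mul_monomial, List.prod_cons,
        List.length_cons, add_comm]
  have hG : Ψ (mlGen c) = monomial m (mlGen c) := by
    rw [mlGen, mlEval_map]
    simp only [mlEval, map_sum]
    refine Finset.sum_congr rfl fun σ _ => ?_
    have h := hl (List.ofFn fun i => MonoidAlgebra.single (FreeMonoid.of (σ i)) 1)
    rw [List.length_ofFn, List.map_ofFn] at h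
    rw [← smul_monomial, ← h]
    congr 3
    ext1 i
    simp [Ψ, ψ]
  have h1 : aeval (monomial m (mlGen c)) p = 0 := by
    rw [← hG, aeval_algHom_apply, hp, map_zero]
  ext k
  have h2 := congrArg (fun g => coeff g (m * k)) h1
  simp only [aeval_eq_sum_range, finsetSum_coeff, coeff_smul, monomial_pow, coeff_monomial,
    coeff_zero] at h2
  by_contra hk
  rw [Finset.sum_eq_single k] at h2
  · rw [if_pos rfl] at h2
    rcases smul_eq_zero.1 h2 with h | h
    · exact hk h
    · exact pow_ne_zero k (mlGen_ne_zero c hc) h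
  · intro b _ hb
    rw [if_neg, smul_zero]
    intro h
    exact hb (Nat.eq_of_mul_eq_mul_left (Nat.pos_of_ne_zero hm) h)
  · intro hk'
    exact absurd (le_natDegree_of_ne_zero hk) (by simpa using hk')

/-- Let `D` be a division ring whose center `F` is infinite, and let `f(x_1,…,x_m)` be a
multilinear polynomial over `F` that is non-central over `M_2(F)`. If for every choice of
nonzero `a_1,…,a_m ∈ D` the value `f(a_1,…,a_m)` is algebraic over `F` of degree at most
some fixed bound, then `D` is finite-dimensional over `F`. -/
theorem finiteDimensional_of_multilinear_algebraic_bounded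
    {F D : Type*} [Field F] [Infinite F] [DivisionRing D] [Algebra F D]
    (hcenter : Set.range (algebraMap F D) = Set.center D)
    {m : ℕ} (c : Equiv.Perm (Fin m) → F)
    (hf : ¬ ∀ T : Fin m → Matrix (Fin 2) (Fin 2) F, ∃ a : F,
      mlEval c T = a • (1 : Matrix (Fin 2) (Fin 2) F))
    (halg : ∃ d : ℕ, ∀ a : Fin m → D, (∀ i, a i ≠ 0) →
      ∃ p : Polynomial F, p ≠ 0 ∧ p.natDegree ≤ d ∧
        Polynomial.aeval (mlEval c a) p = 0) :
    FiniteDimensional F D := by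
  classical
  obtain ⟨d, hd⟩ := halg
  have hc : c ≠ 0 := by
    rintro rfl
    exact hf fun T => ⟨0, by simp [mlEval]⟩
  have hm : m ≠ 0 := by
    rintro rfl
    exact hf fun T => ⟨c 1, by simp [mlEval]⟩
  by_contra hinf
  let W : Finset (FreeMonoid (Fin m)) :=
    (Finset.range (d + 1)).biUnion fun k => (mlGen c ^ k).coeff.support
  let N : ℕ := W.sup FreeMonoid.length + 1
  obtain ⟨x, hx⟩ := words_indep (α := Fin m) hcenter hinf N
  have hx0 : ∀ i, x i ≠ 0 := by
    intro i
    have := hx.ne_zero (i := [i]) (by simp [N])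
    simpa [wordEv] using this
  obtain ⟨p, hp0, hpd, hp⟩ := hd x hx0
  apply hp0
  apply mlGen_transc hm c hc
  let Φ := MonoidAlgebra.lift F D (FreeMonoid (Fin m)) (FreeMonoid.lift x)
  have hΦ : Φ (mlGen c) = mlEval c x := by
    rw [mlGen, mlEval_map]
    congr 1
    ext1 i
    simp [Φ]
  rw [← hΦ, aeval_algHom_apply] at hp
  set g := aeval (mlGen c) p with hg
  have hgW : g.coeff.support ⊆ W := by
    rw [hg, aeval_eq_sum_range' (Nat.lt_succ_of_le hpd), MonoidAlgebra.coeff_sum]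
    refine Finsupp.support_finsetSum.trans ?_
    refine Finset.biUnion_mono fun k _ => ?_
    rw [MonoidAlgebra.coeff_smul]
    exact Finsupp.support_smul
  have hsum : ∑ w ∈ g.coeff.support, g.coeff w • wordEv x w.toList = 0 := by
    rw [← hp]
    simp only [Φ, MonoidAlgebra.lift_apply, Finsupp.sum, FreeMonoid.lift_apply, wordEv]
  have hz : g.coeff = 0 := by
    have hli : LinearIndepOn F (wordEv x) (g.coeff.support.image FreeMonoid.toList :
        Finset (List (Fin m))) := by
      refine hx.mono fun l hl => ?_
      obtain ⟨w, hw, rfl⟩ := Finset.mem_image.1 hl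
      have : w.length ≤ W.sup FreeMonoid.length := Finset.le_sup (f := FreeMonoid.length) (hgW hw)
      exact this.trans (Nat.le_succ _)
    have h := linearIndepOn_finset_iff.1 hli (fun l => g.coeff (FreeMonoid.ofList l)) (by
      rw [Finset.sum_image (by intro a _ b _ h; exact FreeMonoid.toList.injective h)]
      simpa using hsum)
    ext w
    by_cases hw : w ∈ g.coeff.support
    · simpa using h w.toList (Finset.mem_image_of_mem _ hw)
    · simpa using hw
  exact MonoidAlgebra.coeff_injective (by simpa using hz)
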